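/- arXiv:math/0410454 — 2 statements merged into one kernel-verified Lean document; each statement's English description precedes it below -/
import Mathlib

section
/- Define two elements of B⁺ to be conjugate by cyclic permutation if they are equivalent under the equivalence relation on B⁺ generated by uv ∼ vu for u, v ∈ B⁺. Then every element of B⁺ is conjugate by cyclic permutation to an element of the form π^n·y or π^n·(𝐰₀y𝐰₀⁻¹), where n ≥ 0 and y belongs to the following list (note that 𝐰₀y𝐰₀⁻¹ ∈ B⁺, conjugation by 𝐰₀ being the automorphism of B⁺ exchanging 𝐬 and 𝐭): (i) 𝐬^a with a ≥ 0; (ii) 𝐬𝐭; (iii) 𝐬^{a₁}𝐭^{a₂}𝐬^{a₃}⋯𝐬^{a_{2k−1}}𝐭^{a_{2k}} with k ≥ 1, all a_i ≥ 2, and the sequence (a₁, …, a_{2k}) lexicographically greater than or equal to each of its cyclic shifts (indices taken mod 2k); (iv) 𝐰₀𝐬^a with a ∈ {0, 1}; (v) 𝐰₀𝐬^{a₁}𝐭^{a₂}𝐬^{a₃}⋯𝐭^{a_{2k−2}}𝐬^{a_{2k−1}} with k ≥ 1, all a_i ≥ 2, and the sequence (a₁, …, a_{2k−1}) lexicographically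 greater than or equal to each of its cyclic shifts (indices taken mod 2k−1). -/
/-!
The Artin–Tits braid monoid `B⁺` of type `A₂`: two generators `𝐬, 𝐭` (indexed by
`true, false`) and the single relation `𝐬𝐭𝐬 = 𝐭𝐬𝐭`; the braid group `B` with the same
presentation; `𝐰₀ = 𝐬𝐭𝐬` and `π = 𝐰₀²`.
-/

/-- The braid relation `sts = tst` of type `A₂`. -/
def a2Rel : FreeMonoid Bool → FreeMonoid Bool → Prop := fun a b =>
  a = FreeMonoid.of true * FreeMonoid.of false * FreeMonoid.of true ∧
  b = FreeMonoid.of false * FreeMonoid.of true * FreeMonoid.of false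

/-- The braid monoid `B⁺` of type `A₂`. -/
abbrev A2Monoid := PresentedMonoid a2Rel

/-- The generators of `B⁺`. -/
def a2Gen (g : Bool) : A2Monoid := PresentedMonoid.of a2Rel g

/-- The generator `𝐬`. -/
def sB : A2Monoid := a2Gen true

/-- The generator `𝐭`. -/
def tB : A2Monoid := a2Gen false

/-- `𝐰₀ = 𝐬𝐭𝐬`. -/
def w0B : A2Monoid := sB * tB * sB

/-- `π = 𝐰₀²`. -/
def piB : A2Monoid := w0B * w0B

/-- The alternating product `g^{a₁}·g'^{a₂}·g^{a₃}⋯` in `B⁺` attached to a list of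
exponents, starting with the generator `g`. -/
def altPow : Bool → List ℕ → A2Monoid
  | _, [] => 1
  | g, a :: rest => a2Gen g ^ a * altPow (!g) rest

/-- A list is lexicographically greater than or equal to all of its cyclic shifts. -/
def CyclicallyMaximal (L : List ℕ) : Prop :=
  ∀ d : ℕ, ¬ List.Lex (· < ·) L (L.rotate d)

/-- Membership in the list of canonical representatives (i)–(v). -/
def Shape (y : A2Monoid) : Prop :=
  -- (i) `𝐬^a`, `a ≥ 0`
  (∃ a : ℕ, y = sB ^ a) ∨
  -- (ii) `𝐬𝐭`
  (y = sB * tB) ∨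
  -- (iii) `𝐬^{a₁}𝐭^{a₂}⋯𝐬^{a_{2k-1}}𝐭^{a_{2k}}`, `k ≥ 1`, `a_i ≥ 2`, cyclically maximal
  (∃ (k : ℕ) (L : List ℕ), 1 ≤ k ∧ L.length = 2 * k ∧ (∀ a ∈ L, 2 ≤ a) ∧
    CyclicallyMaximal L ∧ y = altPow true L) ∨
  -- (iv) `𝐰₀𝐬^a`, `a ∈ {0, 1}`
  (∃ a : ℕ, a ≤ 1 ∧ y = w0B * sB ^ a) ∨
  -- (v) `𝐰₀𝐬^{a₁}𝐭^{a₂}⋯𝐬^{a_{2k-1}}`, `k ≥ 1`, `a_i ≥ 2`, cyclically maximal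
  (∃ (k : ℕ) (L : List ℕ), 1 ≤ k ∧ L.length = 2 * k - 1 ∧ (∀ a ∈ L, 2 ≤ a) ∧
    CyclicallyMaximal L ∧ y = w0B * altPow true L)

/-- Conjugacy by cyclic permutation in `B⁺`: the equivalence relation generated by
`uv ∼ vu`. -/
def CyclicConj (x y : A2Monoid) : Prop :=
  Relation.EqvGen (fun a b : A2Monoid => ∃ u v : A2Monoid, a = u * v ∧ b = v * u) x y

theorem a2Gen_braid (g : Bool) : a2Gen g * a2Gen (!g) * a2Gen g = w0B := by
  cases g
  · exact (PresentedMonoid.mk_eq_mk_of_rel ⟨rfl, rfl⟩).symm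
  · rfl

theorem w0B_mul_gen (g : Bool) : w0B * a2Gen g = a2Gen (!g) * w0B := by
  calc w0B * a2Gen g = a2Gen (!g) * a2Gen g * a2Gen (!g) * a2Gen g := by
        have h := a2Gen_braid (!g)
        rw [Bool.not_not] at h
        rw [h]
    _ = a2Gen (!g) * (a2Gen g * a2Gen (!g) * a2Gen g) := by simp only [mul_assoc]
    _ = a2Gen (!g) * w0B := by rw [a2Gen_braid]

theorem w0B_mul_gen_pow (g : Bool) (a : ℕ) :
    w0B * a2Gen g ^ a = a2Gen (!g) ^ a * w0B := by
  have h : SemiconjBy w0B (a2Gen g) (a2Gen (!g)) := w0B_mul_gen g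
  exact h.pow_right a

theorem w0B_pow_mul_gen_pow (m : ℕ) (g : Bool) (a : ℕ) :
    w0B ^ m * a2Gen g ^ a = a2Gen (m.bodd ^^ g) ^ a * w0B ^ m := by
  induction m with
  | zero => simp
  | succ m ih =>
    rw [pow_succ', mul_assoc, ih, ← mul_assoc, w0B_mul_gen_pow, mul_assoc]
    simp

theorem altPow_append (g : Bool) (L M : List ℕ) :
    altPow g (L ++ M) = altPow g L * altPow (L.length.bodd ^^ g) M := by
  induction L generalizing g with
  | nil => simp [altPow]
  | cons a L ih => simp [altPow, ih, mul_assoc]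

theorem exists_eq_altPow (w : A2Monoid) : ∃ L, w = altPow true L := by
  obtain ⟨x, rfl⟩ := PresentedMonoid.surjective_mk w
  induction x using FreeMonoid.inductionOn' with
  | one => exact ⟨[], rfl⟩
  | of_mul g x ih =>
    obtain ⟨L, hL⟩ := ih
    rw [map_mul, hL]
    change ∃ L', a2Gen g * _ = _
    cases g
    · exact ⟨0 :: 1 :: L, by simp [altPow]⟩
    · exact ⟨1 :: 0 :: L, by simp [altPow]⟩

theorem CyclicConj.swap (u v : A2Monoid) : CyclicConj (u * v) (v * u) :=
  .rel _ _ ⟨u, v, rfl, rfl⟩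

/-- If `m + |L|` is even, the exponents of `𝐰₀^m·altPow g L` may be rotated cyclically. -/
theorem cyclicConj_rotate_one {m : ℕ} (g : Bool) {a : ℕ} {R : List ℕ}
    (h : (m + (a :: R).length).bodd = false) :
    CyclicConj (w0B ^ m * altPow g (a :: R)) (w0B ^ m * altPow (!g) (R ++ [a])) := by
  have hg : (R.length.bodd ^^ !g) = (m.bodd ^^ g) := by
    simp only [List.length_cons, Nat.bodd_add, Nat.bodd_succ] at h
    revert h
    cases m.bodd <;> cases R.length.bodd <;> cases g <;> decide
  rw [altPow_append, hg, altPow, ← mul_assoc, w0B_pow_mul_gen_pow, mul_assoc, ← mul_assoc]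
  simpa [altPow, mul_assoc] using
    CyclicConj.swap (a2Gen (m.bodd ^^ g) ^ a) (w0B ^ m * altPow (!g) R)

theorem cyclicConj_rotate {m : ℕ} (g : Bool) (L : List ℕ)
    (h : (m + L.length).bodd = false) (d : ℕ) :
    ∃ g', CyclicConj (w0B ^ m * altPow g L) (w0B ^ m * altPow g' (L.rotate d)) := by
  induction d with
  | zero => exact ⟨g, by simpa using .refl _⟩
  | succ d ih =>
    obtain ⟨g', hg'⟩ := ih
    rw [← List.rotate_rotate]
    have hl : (m + (L.rotate d).length).bodd = false := by simpa using h
    generalize L.rotate d = M at hg' hl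
    cases M with
    | nil => exact ⟨g', by simpa using hg'⟩
    | cons a R =>
      rw [List.rotate_cons_succ, List.rotate_zero]
      exact ⟨!g', hg'.trans _ _ _ (cyclicConj_rotate_one g' hl)⟩

/-- If `m + |L|` is odd, the last exponent of `𝐰₀^m·altPow g L` may be merged into the first. -/
theorem cyclicConj_merge {m : ℕ} (g : Bool) {a b : ℕ} {R : List ℕ}
    (h : (m + R.length).bodd = true) :
    CyclicConj (w0B ^ m * altPow g (a :: (R ++ [b]))) (w0B ^ m * altPow g ((b + a) :: R)) := by
  have hg : (R.length.bodd ^^ !g) = (m.bodd ^^ g) := by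
    simp only [Nat.bodd_add] at h
    revert h
    cases m.bodd <;> cases R.length.bodd <;> cases g <;> decide
  have h1 : w0B ^ m * altPow g (a :: (R ++ [b])) =
      (w0B ^ m * altPow g (a :: R)) * a2Gen (m.bodd ^^ g) ^ b := by
    simp only [altPow, altPow_append, hg, mul_assoc, mul_one]
  have h2 : w0B ^ m * altPow g ((b + a) :: R) =
      a2Gen (m.bodd ^^ g) ^ b * (w0B ^ m * altPow g (a :: R)) := by
    simp only [altPow, pow_add]
    rw [← mul_assoc (a2Gen _ ^ b) (w0B ^ m), ← w0B_pow_mul_gen_pow]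
    simp only [mul_assoc]
  rw [h1, h2]
  exact .swap _ _

/-- An interior exponent `1` between two positive exponents produces a factor `𝐰₀`. -/
theorem altPow_one_interior (g : Bool) (a b : ℕ) (R : List ℕ) :
    altPow g ((a + 1) :: 1 :: (b + 1) :: R) = w0B * altPow (!g) (a :: b :: R) := by
  have h := a2Gen_braid g
  simp only [altPow, Bool.not_not, pow_one]
  rw [← mul_assoc w0B, w0B_mul_gen_pow, Bool.not_not, ← h, pow_succ, pow_succ']
  simp only [mul_assoc]

theorem exists_cyclicallyMaximal_rotate (L : List ℕ) :
    ∃ d, CyclicallyMaximal (L.rotate d) := by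
  obtain ⟨d, -, hd⟩ := Finset.exists_max_image (Finset.range (L.length + 1))
    (fun d => L.rotate d) ⟨0, by simp⟩
  refine ⟨d, fun e he => ?_⟩
  rw [List.rotate_rotate, ← List.rotate_mod L (d + e)] at he
  have hmem : (d + e) % L.length ∈ Finset.range (L.length + 1) := by
    rcases L.length.eq_zero_or_pos with h0 | h0
    · simp only [List.length_eq_zero_iff] at h0
      subst h0
      simp at he
    · have := Nat.mod_lt (d + e) h0
      rw [Finset.mem_range]
      omega
  exact absurd he (not_lt.mpr (hd _ hmem))

theorem exists_rotate_eq_cons {c : ℕ} {L : List ℕ} (h : c ∈ L) :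
    ∃ d R, L.rotate d = c :: R := by
  obtain ⟨A, B, rfl⟩ := List.append_of_mem h
  exact ⟨A.length, B ++ A, by simp⟩

theorem exists_rotate_eq_cons_cons {c : ℕ} {L : List ℕ} (h : c ∈ L) (hL : 2 ≤ L.length) :
    ∃ d a R, L.rotate d = a :: c :: R := by
  obtain ⟨d, R, hR⟩ := exists_rotate_eq_cons h
  have hlen : R.length + 1 = L.length := by
    rw [← List.length_rotate L d, hR, List.length_cons]
  obtain rfl | ⟨A, a, rfl⟩ := R.eq_nil_or_concat
  · simp at hlen; omega
  · refine ⟨d + (A.length + 1), a, A, ?_⟩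
    rw [← List.rotate_rotate, hR]
    simp

/-- `w` is conjugate by cyclic permutation to a canonical representative, up to `τ` and a power
of `π`. -/
def HasCanonicalForm (τ : A2Monoid →* A2Monoid) (w : A2Monoid) : Prop :=
  ∃ (n : ℕ) (y : A2Monoid), Shape y ∧
    (CyclicConj w (piB ^ n * y) ∨ CyclicConj w (piB ^ n * τ y))

theorem HasCanonicalForm.of_cyclicConj {τ : A2Monoid →* A2Monoid} {v w : A2Monoid}
    (h : HasCanonicalForm τ w) (hc : CyclicConj v w) : HasCanonicalForm τ v := by
  obtain ⟨n, y, hy, h | h⟩ := h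
  · exact ⟨n, y, hy, .inl (hc.trans _ _ _ h)⟩
  · exact ⟨n, y, hy, .inr (hc.trans _ _ _ h)⟩

section Automorphism

variable {τ : A2Monoid →* A2Monoid}

theorem map_a2Gen (hτs : τ sB = tB) (hτt : τ tB = sB) (g : Bool) :
    τ (a2Gen g) = a2Gen (!g) := by
  cases g
  · exact hτt
  · exact hτs

theorem map_w0B (hτ : ∀ g, τ (a2Gen g) = a2Gen (!g)) : τ w0B = w0B := by
  rw [← a2Gen_braid true, map_mul, map_mul, hτ, hτ]
  exact (a2Gen_braid false).trans (a2Gen_braid true).symm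

theorem map_altPow (hτ : ∀ g, τ (a2Gen g) = a2Gen (!g)) (g : Bool) (L : List ℕ) :
    τ (altPow g L) = altPow (!g) L := by
  induction L generalizing g with
  | nil => simp [altPow]
  | cons a L ih => simp [altPow, ih, hτ]

theorem hasCanonicalForm_even (hτ : ∀ g, τ (a2Gen g) = a2Gen (!g)) {m : ℕ}
    (hm : m.bodd = false) (g : Bool) {L : List ℕ} (hL : Shape (altPow true L)) :
    HasCanonicalForm τ (w0B ^ m * altPow g L) := by
  have hπ : piB ^ m.div2 = w0B ^ m := by
    conv_rhs => rw [← Nat.bodd_add_div2 m, hm]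
    simp [piB, ← pow_two, ← pow_mul]
  refine ⟨m.div2, _, hL, ?_⟩
  rw [hπ, map_altPow hτ]
  cases g
  · exact .inr (.refl _)
  · exact .inl (.refl _)

theorem hasCanonicalForm_odd (hτ : ∀ g, τ (a2Gen g) = a2Gen (!g)) {m : ℕ}
    (hm : m.bodd = true) (g : Bool) {L : List ℕ} (hL : Shape (w0B * altPow true L)) :
    HasCanonicalForm τ (w0B ^ m * altPow g L) := by
  have hπ : piB ^ m.div2 * w0B = w0B ^ m := by
    conv_rhs => rw [← Nat.bodd_add_div2 m, hm]
    simp only [Bool.toNat_true, add_comm 1, pow_succ, pow_mul, piB, pow_zero, one_mul]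
  refine ⟨m.div2, _, hL, ?_⟩
  rw [map_mul, map_altPow hτ, map_w0B hτ, ← mul_assoc, ← mul_assoc, hπ]
  cases g
  · exact .inr (.refl _)
  · exact .inl (.refl _)

theorem hasCanonicalForm_of_two_le (hτ : ∀ g, τ (a2Gen g) = a2Gen (!g)) {m : ℕ} (g : Bool)
    {L : List ℕ} (h : (m + L.length).bodd = false) (hL : ∀ a ∈ L, 2 ≤ a) :
    HasCanonicalForm τ (w0B ^ m * altPow g L) := by
  obtain ⟨d, hd⟩ := exists_cyclicallyMaximal_rotate L
  obtain ⟨g', hg'⟩ := cyclicConj_rotate g L h d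
  refine HasCanonicalForm.of_cyclicConj ?_ hg'
  have hlen := List.length_rotate L d
  have hmem : ∀ a ∈ L.rotate d, 2 ≤ a := by simpa using hL
  have hdiv := Nat.bodd_add_div2 L.length
  generalize L.rotate d = M at hd hlen hmem
  rw [Nat.bodd_add] at h
  cases hm : m.bodd
  · rw [hm, Bool.false_xor] at h
    simp only [h, Bool.toNat_false] at hdiv
    refine hasCanonicalForm_even hτ hm g' ?_
    rcases Nat.eq_zero_or_pos L.length.div2 with h0 | h0
    · obtain rfl : M = [] := List.length_eq_zero_iff.mp (by omega)
      exact .inl ⟨0, by simp [altPow]⟩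
    · exact .inr (.inr (.inl ⟨_, M, h0, by omega, hmem, hd, rfl⟩))
  · have h' : L.length.bodd = true := by simpa [hm] using h
    simp only [h', Bool.toNat_true] at hdiv
    refine hasCanonicalForm_odd hτ hm g' ?_
    exact .inr (.inr (.inr (.inr ⟨L.length.div2 + 1, M, by omega, by omega, hmem, hd, rfl⟩)))

theorem hasCanonicalForm_singleton (hτ : ∀ g, τ (a2Gen g) = a2Gen (!g)) {m : ℕ}
    (hm : m.bodd = false) (g : Bool) (a : ℕ) :
    HasCanonicalForm τ (w0B ^ m * altPow g [a]) :=
  hasCanonicalForm_even hτ hm g (.inl ⟨a, by simp [altPow, sB]⟩)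

theorem hasCanonicalForm_altPow (hτ : ∀ g, τ (a2Gen g) = a2Gen (!g)) (m : ℕ) (g : Bool)
    (L : List ℕ) : HasCanonicalForm τ (w0B ^ m * altPow g L) := by
  induction hN : L.sum + L.length using Nat.strong_induction_on generalizing m g L with
  | _ N ih =>
  subst hN
  cases hpar : (m + L.length).bodd
  swap
  · rcases L with _ | ⟨a, R⟩
    · exact hasCanonicalForm_odd hτ (by simpa using hpar) g
        (.inr (.inr (.inr (.inl ⟨0, by simp, by simp [altPow]⟩))))
    obtain rfl | ⟨A, b, rfl⟩ := R.eq_nil_or_concat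
    · exact hasCanonicalForm_singleton hτ (by simpa using hpar) g a
    · rw [List.concat_eq_append] at *
      refine (ih _ ?_ m g ((b + a) :: A) rfl).of_cyclicConj (cyclicConj_merge g ?_)
      · simp; omega
      · simpa using hpar
  by_cases h2 : ∀ a ∈ L, 2 ≤ a
  · exact hasCanonicalForm_of_two_le hτ g hpar h2
  have hrot (d : ℕ) {M : List ℕ} (hM : L.rotate d = M) :
      (∃ g', CyclicConj (w0B ^ m * altPow g L) (w0B ^ m * altPow g' M)) ∧
        M.sum = L.sum ∧ M.length = L.length ∧ ∀ a ∈ M, a ∈ L := by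
    subst hM
    exact ⟨cyclicConj_rotate g L hpar d, (List.rotate_perm L d).sum_eq, by simp, by simp⟩
  by_cases h0 : 0 ∈ L
  · obtain ⟨d, R, hR⟩ := exists_rotate_eq_cons h0
    obtain ⟨⟨g', hg'⟩, hs, hl, -⟩ := hrot d hR
    refine HasCanonicalForm.of_cyclicConj ?_ hg'
    simp only [List.sum_cons, List.length_cons] at hs hl
    simpa [altPow] using ih _ (by omega) m (!g') R rfl
  have hpos : ∀ a ∈ L, 1 ≤ a := fun a ha => Nat.pos_of_ne_zero fun h => h0 (h ▸ ha)
  have h1 : 1 ∈ L := by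
    push Not at h2
    obtain ⟨a, ha, ha2⟩ := h2
    have := hpos a ha
    obtain rfl : a = 1 := by omega
    exact ha
  by_cases hlen : 2 ≤ L.length
  swap
  · obtain rfl : L = [1] := by
      rcases L with _ | ⟨a, _ | ⟨b, R⟩⟩ <;> simp_all
    exact hasCanonicalForm_odd hτ (by simpa using hpar) g
      (.inr (.inr (.inr (.inl ⟨1, le_rfl, by simp [altPow, sB]⟩))))
  obtain ⟨d, a, R, hR⟩ := exists_rotate_eq_cons_cons h1 hlen
  obtain ⟨⟨g', hg'⟩, hs, hl, hmem⟩ := hrot d hR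
  refine HasCanonicalForm.of_cyclicConj ?_ hg'
  have ha := hpos a (hmem a (by simp))
  rcases R with _ | ⟨b, R⟩
  · have hm : m.bodd = false := by simpa [← hl] using hpar
    rcases a with _ | _ | a
    · omega
    · exact hasCanonicalForm_even hτ hm g' (.inr (.inl (by simp [altPow, sB, tB])))
    · have hc : CyclicConj (w0B ^ m * altPow g' [a + 1, 1, 1])
          (w0B ^ m * altPow g' [1 + (a + 1), 1]) :=
        cyclicConj_merge g' (R := [1]) (by simpa using hm)
      rw [add_comm 1] at hc
      refine HasCanonicalForm.of_cyclicConj ?_ (hc.symm _ _)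
      simp only [List.sum_cons, List.length_cons] at hs hl
      have := ih _ (by simp at *; omega) (m + 1) (!g') [a, 0] rfl
      rwa [pow_succ, mul_assoc, ← altPow_one_interior] at this
  · have hb := hpos b (hmem b (by simp))
    obtain ⟨a, rfl⟩ := Nat.exists_eq_add_of_le' ha
    obtain ⟨b, rfl⟩ := Nat.exists_eq_add_of_le' hb
    rw [altPow_one_interior, ← mul_assoc, ← pow_succ]
    simp only [List.sum_cons, List.length_cons] at hs hl
    exact ih _ (by simp; omega) (m + 1) (!g') (a :: b :: R) rfl

end Automorphism

/-- Every element of `B⁺` is conjugate by cyclic permutation to an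
element of the form `π^n·y` or `π^n·(𝐰₀y𝐰₀⁻¹)` with `n ≥ 0` and `y` in the list
(i)–(v). Here `τ` is the automorphism of `B⁺` given by conjugation by `𝐰₀`, which
exchanges `𝐬` and `𝐭` (so that `𝐰₀y𝐰₀⁻¹ = τ(y) ∈ B⁺`). -/
theorem stmt1 (τ : A2Monoid →* A2Monoid) (hτs : τ sB = tB) (hτt : τ tB = sB)
    (w : A2Monoid) :
    ∃ (n : ℕ) (y : A2Monoid), Shape y ∧
      (CyclicConj w (piB ^ n * y) ∨ CyclicConj w (piB ^ n * τ y)) := by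
  obtain ⟨L, rfl⟩ := exists_eq_altPow w
  have h := hasCanonicalForm_altPow (map_a2Gen hτs hτt) 0 true L
  rwa [pow_zero, one_mul] at h
end

section
/- Let w, w₁, w₂ ∈ B⁺, let x ∈ Hom_{D⁺}(w, w₁) and y ∈ Hom_{D⁺}(w, w₂). Then there exist u ∈ B⁺, x′ ∈ Hom_{D⁺}(w₁, u) and y′ ∈ Hom_{D⁺}(w₂, u) such that x·x′ = y·y′ in B⁺. -/
/-!
Artin–Tits braid monoid of a finite Coxeter system `(W,S)`, presented with one
generator `𝐰` for each `w ∈ W` and relations `𝐰₁𝐰₂ = 𝐰` when `w = w₁w₂` with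
`l(w₁) + l(w₂) = l(w)`.
-/

variable {B : Type*} {W : Type*} [Group W] {M : CoxeterMatrix B}

/-- The defining relations of the braid monoid. -/
def braidRel (cs : CoxeterSystem M W) : FreeMonoid W → FreeMonoid W → Prop := fun a b =>
  ∃ w₁ w₂ : W, cs.length (w₁ * w₂) = cs.length w₁ + cs.length w₂ ∧
    a = FreeMonoid.of w₁ * FreeMonoid.of w₂ ∧ b = FreeMonoid.of (w₁ * w₂)

/-- The braid monoid `B⁺` of the Coxeter system `cs`. -/
abbrev BraidMonoid (cs : CoxeterSystem M W) := PresentedMonoid (braidRel cs)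

/-- The canonical element `𝐰 ∈ B⁺` attached to `w ∈ W`. -/
def bOf (cs : CoxeterSystem M W) (w : W) : BraidMonoid cs := PresentedMonoid.of (braidRel cs) w

/-- The canonical morphism `β : B⁺ → W`, `𝐰 ↦ w`. -/
noncomputable def bPi (cs : CoxeterSystem M W) : BraidMonoid cs →* W :=
  PresentedMonoid.lift (fun w : W => w) (by
    rintro a b ⟨w₁, w₂, -, rfl, rfl⟩
    simp)

/-- The additive length morphism `l : B⁺ → ℕ` with `l(𝐬) = 1`; recorded as a morphism
to `Multiplicative ℕ`. It sends `𝐰` to `l(w)`. -/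
noncomputable def bLen (cs : CoxeterSystem M W) : BraidMonoid cs →* Multiplicative ℕ :=
  PresentedMonoid.lift (fun w : W => Multiplicative.ofAdd (cs.length w)) (by
    rintro a b ⟨w₁, w₂, h, rfl, rfl⟩
    simp [← ofAdd_add, h])

/-- The set `𝐖 = {b ∈ B⁺ : l(b) = l(β(b))}`, a copy of `W` inside `B⁺`. -/
def bW (cs : CoxeterSystem M W) : Set (BraidMonoid cs) :=
  {b | bLen cs b = Multiplicative.ofAdd (cs.length (bPi cs b))}


/-- `EChain cs F w w' L` says that the list `L = (y₁, …, y_n)` is a chain from `w` to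
`w'`: there are `w = w₁, w₂, …, w_{n+1} = w'` with `y_i ≼ w_i` and
`y_i·w_{i+1} = w_i·F(y_i)` for all `i`. Thus `ℰ(y, w, w')` is the set of lists `L`
with product `y` satisfying `EChain cs F w w' L`. -/
inductive EChain (cs : CoxeterSystem M W) (F : BraidMonoid cs →* BraidMonoid cs) :
    BraidMonoid cs → BraidMonoid cs → List (BraidMonoid cs) → Prop
  | nil (w : BraidMonoid cs) : EChain cs F w w []
  | cons {w w₁ w' y : BraidMonoid cs} {L : List (BraidMonoid cs)} :
      (∃ z, y * z = w) → y * w₁ = w * F y → EChain cs F w₁ w' L →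
      EChain cs F w w' (y :: L)

namespace CoxeterSystem

/-! ### The reflection cocycle and the exchange property -/

open Classical in
/-- The action of the `i`-th simple reflection on signed elements of `W`. -/
noncomputable def signedConj (cs : CoxeterSystem M W) (i : B) : Function.End (W × ZMod 2) :=
  fun p => (cs.simple i * p.1 * cs.simple i, p.2 + if p.1 = cs.simple i then 1 else 0)

open Classical in
theorem signedConj_mul_pow_apply (cs : CoxeterSystem M W) (i j : B) (m : ℕ) (t : W) (ε : ZMod 2) :
    ((cs.signedConj i * cs.signedConj j) ^ m) (t, ε) =
      ((cs.simple i * cs.simple j) ^ m * t * ((cs.simple i * cs.simple j) ^ m)⁻¹,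
        ε + ∑ n ∈ Finset.range (2 * m),
          if t = cs.simple j * (cs.simple i * cs.simple j) ^ n then 1 else 0) := by
  have hinv : ∀ k : ℕ, ((cs.simple i * cs.simple j) ^ k)⁻¹ * cs.simple j =
      cs.simple j * (cs.simple i * cs.simple j) ^ k := by
    intro k
    induction k with
    | zero => simp
    | succ k ih =>
      rw [pow_succ' _ k, mul_inv_rev, mul_assoc, mul_inv_rev, cs.inv_simple, cs.inv_simple,
        mul_assoc (cs.simple j), mul_assoc, ← mul_assoc _ (cs.simple j), ih]
      have h : (cs.simple i * cs.simple j) ^ k * (cs.simple i * cs.simple j) =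
        (cs.simple i * cs.simple j) * (cs.simple i * cs.simple j) ^ k := by
        rw [← pow_succ, ← pow_succ']
      simp only [mul_assoc] at h ⊢
      rw [h]
  induction m with
  | zero => simp [Function.End.one_def]
  | succ m ih =>
    rw [pow_succ']
    change (cs.signedConj i * cs.signedConj j)
      (((cs.signedConj i * cs.signedConj j) ^ m) (t, ε)) = _
    rw [ih]
    set r := cs.simple i * cs.simple j with hr
    have hj : r ^ m * t * (r ^ m)⁻¹ = cs.simple j ↔ t = cs.simple j * r ^ (2 * m) := by
      rw [two_mul, pow_add, ← mul_assoc, ← hinv, mul_inv_eq_iff_eq_mul, mul_assoc (r ^ m)⁻¹,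
        eq_inv_mul_iff_mul_eq]
    have hi : cs.simple j * (r ^ m * t * (r ^ m)⁻¹) * cs.simple j = cs.simple i ↔
        t = cs.simple j * r ^ (2 * m + 1) := by
      have h : r ^ (2 * m + 1) = r ^ m * r * r ^ m := by
        rw [← pow_succ, ← pow_add]; congr 1; ring
      rw [h, mul_assoc (r ^ m), ← mul_assoc, ← hinv]
      generalize r ^ m = a
      rw [hr]
      constructor
      · intro h
        rw [← h]
        simp [mul_assoc]
      · rintro rfl
        simp [mul_assoc]
    rw [show 2 * (m + 1) = 2 * m + 1 + 1 by ring, Finset.sum_range_succ, Finset.sum_range_succ]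
    change (_, _) = _
    simp only [signedConj, hj, hi, Prod.mk.injEq]
    refine ⟨?_, by ring⟩
    rw [pow_succ', mul_inv_rev, hr]
    simp [mul_assoc]

theorem isLiftable_signedConj (cs : CoxeterSystem M W) : M.IsLiftable cs.signedConj := by
  classical
  intro i j
  funext ⟨t, ε⟩
  rw [signedConj_mul_pow_apply, two_mul, Finset.sum_range_add]
  simp only [pow_add, cs.simple_mul_simple_pow, one_mul, CharTwo.add_self_eq_zero]
  simp [Function.End.one_def]

/-- The reflection cocycle: for a reflection `t` it is nonzero exactly when `t` is a left
inversion of `w`. -/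
noncomputable def reflCocycle (cs : CoxeterSystem M W) (w t : W) : ZMod 2 :=
  (cs.lift ⟨cs.signedConj, cs.isLiftable_signedConj⟩ w⁻¹ (t, 0)).2

theorem lift_signedConj_apply (cs : CoxeterSystem M W) (w t : W) (ε : ZMod 2) :
    cs.lift ⟨cs.signedConj, cs.isLiftable_signedConj⟩ w (t, ε) =
      (w * t * w⁻¹, ε + cs.reflCocycle w⁻¹ t) := by
  rw [reflCocycle, inv_inv]
  induction w using cs.simple_induction_left generalizing t ε with
  | one => simp [Function.End.one_def]
  | mul_simple_left w i ih =>
    have h (ε : ZMod 2) : cs.lift ⟨cs.signedConj, cs.isLiftable_signedConj⟩ (cs.simple i * w)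
        (t, ε) = cs.signedConj i
          (cs.lift ⟨cs.signedConj, cs.isLiftable_signedConj⟩ w (t, ε)) := by
      rw [map_mul, cs.lift_apply_simple]; rfl
    rw [h, h, ih, ih t 0]
    simp [signedConj, mul_assoc, add_assoc]

open Classical in
theorem reflCocycle_simple (cs : CoxeterSystem M W) (i : B) (t : W) :
    cs.reflCocycle (cs.simple i) t = if t = cs.simple i then 1 else 0 := by
  rw [reflCocycle, cs.inv_simple, cs.lift_apply_simple]
  simp [signedConj]

theorem reflCocycle_mul (cs : CoxeterSystem M W) (u v t : W) :
    cs.reflCocycle (u * v) t = cs.reflCocycle u t + cs.reflCocycle v (u⁻¹ * t * u) := by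
  have h := cs.lift_signedConj_apply (v⁻¹ * u⁻¹) t 0
  rw [map_mul] at h
  change cs.lift ⟨cs.signedConj, cs.isLiftable_signedConj⟩ v⁻¹
    (cs.lift ⟨cs.signedConj, cs.isLiftable_signedConj⟩ u⁻¹ (t, 0)) = _ at h
  rw [lift_signedConj_apply, lift_signedConj_apply] at h
  simpa using (congrArg Prod.snd h).symm

theorem length_mul_lt_of_reflCocycle_ne_zero (cs : CoxeterSystem M W) {w t : W}
    (h : cs.reflCocycle w t ≠ 0) : cs.length (t * w) < cs.length w := by
  classical
  obtain ⟨ω, hω, rfl⟩ := cs.exists_isReduced w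
  rw [hω.eq]
  suffices ∃ ω' : List B, t * cs.wordProd ω = cs.wordProd ω' ∧ ω'.length < ω.length by
    obtain ⟨ω', h₁, h₂⟩ := this
    rw [h₁]
    exact (cs.length_wordProd_le ω').trans_lt h₂
  clear hω
  induction ω generalizing t with
  | nil => simp [reflCocycle, Function.End.one_def] at h
  | cons i ω ih =>
    rw [cs.wordProd_cons, reflCocycle_mul, reflCocycle_simple] at h
    by_cases ht : t = cs.simple i
    · exact ⟨ω, by simp [ht, cs.wordProd_cons], by simp⟩
    · rw [if_neg ht, zero_add] at h
      obtain ⟨ω', h₁, h₂⟩ := ih h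
      refine ⟨i :: ω', ?_, by simpa using h₂⟩
      rw [cs.wordProd_cons, cs.wordProd_cons, ← h₁]
      simp [mul_assoc]

theorem reflCocycle_simple_ne_zero_iff (cs : CoxeterSystem M W) (w : W) (i : B) :
    cs.reflCocycle w (cs.simple i) ≠ 0 ↔ cs.length (cs.simple i * w) < cs.length w := by
  refine ⟨cs.length_mul_lt_of_reflCocycle_ne_zero, fun h h₀ => ?_⟩
  have h₁ : cs.reflCocycle (cs.simple i * w) (cs.simple i) ≠ 0 := by
    rw [reflCocycle_mul, reflCocycle_simple]
    simp [h₀]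
  have h₂ := cs.length_mul_lt_of_reflCocycle_ne_zero h₁
  rw [cs.simple_mul_simple_cancel_left] at h₂
  omega

/-- A form of the exchange property. -/
theorem exists_exchange (cs : CoxeterSystem M W) {u z : W} {i : B}
    (hu : cs.length u < cs.length (cs.simple i * u))
    (huz : cs.length (cs.simple i * (u * z)) < cs.length (u * z)) :
    ∃ z', cs.simple i * (u * z) = u * z' ∧ cs.length z' < cs.length z := by
  rw [← reflCocycle_simple_ne_zero_iff, reflCocycle_mul] at huz
  have h₀ : cs.reflCocycle u (cs.simple i) = 0 := by
    by_contra h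
    have := (cs.reflCocycle_simple_ne_zero_iff u i).1 h
    omega
  rw [h₀, zero_add] at huz
  exact ⟨_, by group, cs.length_mul_lt_of_reflCocycle_ne_zero huz⟩

/-! ### The weak order -/

/-- The right weak order: `a` is the beginning of a reduced expression of `b`. -/
def IsPrefix (cs : CoxeterSystem M W) (a b : W) : Prop :=
  cs.length b = cs.length a + cs.length (a⁻¹ * b)

theorem isPrefix_refl (cs : CoxeterSystem M W) (a : W) : cs.IsPrefix a a := by
  simp [IsPrefix]

theorem one_isPrefix (cs : CoxeterSystem M W) (a : W) : cs.IsPrefix 1 a := by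
  simp [IsPrefix]

theorem isPrefix_mul_iff (cs : CoxeterSystem M W) {a b : W} :
    cs.IsPrefix a (a * b) ↔ cs.length (a * b) = cs.length a + cs.length b := by
  simp [IsPrefix]

theorem isPrefix_of_length_le (cs : CoxeterSystem M W) {a b : W}
    (h : cs.length a + cs.length (a⁻¹ * b) ≤ cs.length b) : cs.IsPrefix a b := by
  have := cs.length_mul_le a (a⁻¹ * b)
  rw [mul_inv_cancel_left] at this
  unfold IsPrefix
  omega

theorem length_le_add_inv_mul (cs : CoxeterSystem M W) (a b c : W) :
    cs.length (a⁻¹ * c) ≤ cs.length (a⁻¹ * b) + cs.length (b⁻¹ * c) := by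
  simpa [mul_assoc] using cs.length_mul_le (a⁻¹ * b) (b⁻¹ * c)

variable {cs : CoxeterSystem M W}

theorem IsPrefix.trans {a b c : W} (hab : cs.IsPrefix a b) (hbc : cs.IsPrefix b c) :
    cs.IsPrefix a c := by
  have := cs.length_le_add_inv_mul a b c
  apply isPrefix_of_length_le
  unfold IsPrefix at hab hbc
  omega

theorem IsPrefix.length_inv_mul {a b c : W} (hab : cs.IsPrefix a b) (hbc : cs.IsPrefix b c) :
    cs.length (a⁻¹ * c) = cs.length (a⁻¹ * b) + cs.length (b⁻¹ * c) := by
  have := hab.trans hbc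
  unfold IsPrefix at *
  omega

theorem IsPrefix.antisymm {a b : W} (hab : cs.IsPrefix a b) (hba : cs.IsPrefix b a) : a = b := by
  have : cs.length (a⁻¹ * b) = 0 := by
    unfold IsPrefix at *
    omega
  rw [cs.length_eq_zero_iff] at this
  exact inv_mul_eq_one.1 this

theorem IsPrefix.of_mul {a b d : W} (hab : cs.IsPrefix a (a * b)) (h : cs.IsPrefix (a * b) d) :
    cs.IsPrefix b (a⁻¹ * d) := by
  have := hab.length_inv_mul h
  rw [inv_mul_cancel_left] at this
  rw [IsPrefix, this, mul_inv_rev, mul_assoc]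

theorem IsPrefix.mul {a b d : W} (had : cs.IsPrefix a d) (h : cs.IsPrefix b (a⁻¹ * d)) :
    cs.IsPrefix a (a * b) ∧ cs.IsPrefix (a * b) d := by
  have h₁ := cs.length_mul_le a b
  have h₂ := cs.length_mul_le (a * b) ((a * b)⁻¹ * d)
  rw [mul_inv_cancel_left] at h₂
  simp only [IsPrefix, mul_inv_rev, inv_mul_cancel_left, mul_assoc] at *
  omega

theorem simple_isPrefix_iff {i : B} {w : W} :
    cs.IsPrefix (cs.simple i) w ↔ cs.length (cs.simple i * w) < cs.length w := by
  rw [IsPrefix, cs.inv_simple, cs.length_simple]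
  have := cs.length_simple_mul w i
  omega

/-- If `u` and the simple reflection `s` are both prefixes of `d` and `su` is longer than `u`,
then `su` is a prefix of `d`. -/
theorem IsPrefix.simple_mul {u d : W} {i : B} (hu : cs.length u < cs.length (cs.simple i * u))
    (hi : cs.IsPrefix (cs.simple i) d) (h : cs.IsPrefix u d) :
    cs.IsPrefix (cs.simple i * u) d := by
  rw [simple_isPrefix_iff] at hi
  obtain ⟨z', h₁, h₂⟩ := cs.exists_exchange (z := u⁻¹ * d) hu (by simpa using hi)
  rw [mul_inv_cancel_left] at h₁
  have h₃ : (cs.simple i * u)⁻¹ * d = z' := by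
    rw [mul_inv_rev, cs.inv_simple, mul_assoc, h₁, inv_mul_cancel_left]
  apply isPrefix_of_length_le
  rw [h₃]
  have := cs.length_simple_mul u i
  unfold IsPrefix at h
  omega

variable (cs)

theorem exists_forall_isPrefix [Finite W] : ∃ w₀, ∀ a, cs.IsPrefix a w₀ := by
  obtain ⟨w₀, hw₀⟩ := Finite.exists_max cs.length
  refine ⟨w₀, fun a => ?_⟩
  induction h : cs.length a generalizing a with
  | zero =>
    rw [cs.length_eq_zero_iff] at h
    exact h ▸ cs.one_isPrefix w₀
  | succ n ih =>
    obtain ⟨i, hi⟩ := cs.exists_leftDescent_of_ne_one (w := a) (by rintro rfl; simp at h)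
    have hi' := cs.isLeftDescent_iff.1 hi
    have h₁ := IsPrefix.simple_mul (u := cs.simple i * a) (i := i) (d := w₀)
      (by rw [cs.simple_mul_simple_cancel_left]; exact hi)
      (by
        rw [simple_isPrefix_iff]
        exact lt_of_le_of_ne (hw₀ _) (cs.length_simple_mul_ne w₀ i))
      (ih _ (by omega))
    rwa [cs.simple_mul_simple_cancel_left] at h₁

/-- `j` is the least upper bound of `a` and `b` in the weak order. -/
def IsJoin (a b j : W) : Prop :=
  cs.IsPrefix a j ∧ cs.IsPrefix b j ∧ ∀ d, cs.IsPrefix a d → cs.IsPrefix b d → cs.IsPrefix j d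

theorem exists_isJoin_simple [Finite W] (i k : B) :
    ∃ j, cs.IsJoin (cs.simple i) (cs.simple k) j := by
  let S : Set W := {u | ∀ d, cs.IsPrefix (cs.simple i) d → cs.IsPrefix (cs.simple k) d →
    cs.IsPrefix u d}
  obtain ⟨j, hj, hmax⟩ := Set.exists_max_image S cs.length S.toFinite
    ⟨1, fun d _ _ => cs.one_isPrefix d⟩
  have key : ∀ l, (l = i ∨ l = k) → cs.IsPrefix (cs.simple l) j := by
    intro l hl
    rw [simple_isPrefix_iff]
    by_contra h
    have h₁ := cs.length_simple_mul_ne j l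
    refine absurd (hmax (cs.simple l * j) fun d hi hk => ?_) (by omega)
    refine IsPrefix.simple_mul (by omega) ?_ (hj d hi hk)
    rcases hl with rfl | rfl <;> assumption
  exact ⟨j, key i (.inl rfl), key k (.inr rfl), hj⟩

theorem exists_simple_isPrefix {z a : W} (h : cs.IsPrefix z a) (hne : z ≠ a) :
    ∃ i, cs.IsPrefix z (z * cs.simple i) ∧ cs.IsPrefix (z * cs.simple i) a := by
  obtain ⟨i, hi⟩ := cs.exists_leftDescent_of_ne_one (w := z⁻¹ * a)
    (fun h => hne (inv_mul_eq_one.1 h))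
  exact ⟨i, h.mul (simple_isPrefix_iff.2 hi)⟩

theorem exists_isJoin [Finite W] (a b : W) : ∃ j, cs.IsJoin a b j := by
  obtain ⟨w₀, hw₀⟩ := cs.exists_forall_isPrefix
  suffices ∀ (n : ℕ) (z a b : W), cs.length w₀ ≤ cs.length z + n → cs.IsPrefix z a →
      cs.IsPrefix z b → ∃ j, cs.IsJoin a b j from
    this (cs.length w₀) 1 a b (by simp) (cs.one_isPrefix a) (cs.one_isPrefix b)
  intro n
  induction n with
  | zero =>
    intro z a b hz ha hb
    have h : ∀ c, cs.IsPrefix z c → c = z := by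
      intro c hc
      refine IsPrefix.antisymm ?_ hc
      have h₀ := hw₀ c
      have : cs.length (z⁻¹ * c) = 0 := by
        unfold IsPrefix at h₀ hc
        omega
      rw [cs.length_eq_zero_iff, inv_mul_eq_one] at this
      exact this ▸ cs.isPrefix_refl _
    rw [h a ha, h b hb]
    exact ⟨z, cs.isPrefix_refl z, cs.isPrefix_refl z, fun _ h _ => h⟩
  | succ n ih =>
    intro z a b hz ha hb
    by_cases hza : z = a
    · exact ⟨b, hza ▸ hb, cs.isPrefix_refl b, fun _ _ h => h⟩
    by_cases hzb : z = b
    · exact ⟨a, cs.isPrefix_refl a, hzb ▸ ha, fun _ h _ => h⟩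
    obtain ⟨i, hi, hia⟩ := cs.exists_simple_isPrefix ha hza
    obtain ⟨k, hk, hkb⟩ := cs.exists_simple_isPrefix hb hzb
    obtain ⟨j, hij, hkj, hj⟩ := cs.exists_isJoin_simple i k
    have hjd : ∀ d, cs.IsPrefix (z * cs.simple i) d → cs.IsPrefix (z * cs.simple k) d →
        cs.IsPrefix z (z * j) ∧ cs.IsPrefix (z * j) d := fun d h₁ h₂ =>
      (hi.trans h₁).mul (hj _ (hi.of_mul h₁) (hk.of_mul h₂))
    have hzj := (hjd w₀ (hw₀ _) (hw₀ _)).1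
    have hic := (hzj.mul (b := cs.simple i) (by simpa using hij)).2
    have hkc := (hzj.mul (b := cs.simple k) (by simpa using hkj)).2
    have hli := cs.isPrefix_mul_iff.1 hi
    have hlk := cs.isPrefix_mul_iff.1 hk
    rw [cs.length_simple] at hli hlk
    obtain ⟨j₁, h₁⟩ := ih (z * cs.simple i) a (z * j) (by omega) hia hic
    obtain ⟨j₂, h₂⟩ := ih (z * cs.simple k) j₁ b (by omega) (hkc.trans h₁.2.1) hkb
    exact ⟨j₂, h₁.1.trans h₂.1, h₂.2.1, fun d had hbd => h₂.2.2 d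
      (h₁.2.2 d had (hjd d (hia.trans had) (hkb.trans hbd)).2) hbd⟩

variable {cs} in
theorem IsJoin.eq {a b j j' : W} (h : cs.IsJoin a b j) (h' : cs.IsJoin a b j') : j = j' :=
  (h.2.2 _ h'.1 h'.2.1).antisymm (h'.2.2 _ h.1 h.2.1)

/-- The least upper bound of `a` and `b` in the weak order. -/
noncomputable def join [Finite W] (a b : W) : W := (cs.exists_isJoin a b).choose

theorem isJoin_join [Finite W] (a b : W) : cs.IsJoin a b (cs.join a b) :=
  (cs.exists_isJoin a b).choose_spec

theorem join_comm [Finite W] (a b : W) : cs.join a b = cs.join b a :=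
  have h := cs.isJoin_join b a
  (cs.isJoin_join a b).eq ⟨h.2.1, h.1, fun d h₁ h₂ => h.2.2 d h₂ h₁⟩

/-- The complement `a \ b`, defined by `a ∨ b = a (a \ b)`. -/
noncomputable def compl [Finite W] (a b : W) : W := a⁻¹ * cs.join a b

@[simp] theorem mul_compl [Finite W] (a b : W) : a * cs.compl a b = cs.join a b := by
  simp [compl]

theorem join_mul [Finite W] {w₁ w₂ : W} (h : cs.IsPrefix w₁ (w₁ * w₂)) (a : W) :
    cs.join a (w₁ * w₂) = w₁ * cs.join (cs.compl w₁ a) w₂ ∧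
      cs.IsPrefix (cs.join a w₁) (w₁ * cs.join (cs.compl w₁ a) w₂) := by
  obtain ⟨w₀, hw₀⟩ := cs.exists_forall_isPrefix
  obtain ⟨hw, ha, hle⟩ := cs.isJoin_join w₁ a
  rw [← mul_compl] at hw ha
  obtain ⟨h₁, h₂, h₃⟩ := cs.isJoin_join (cs.compl w₁ a) w₂
  have key : ∀ d, cs.IsPrefix a d → cs.IsPrefix (w₁ * w₂) d →
      cs.IsPrefix w₁ (w₁ * cs.join (cs.compl w₁ a) w₂) ∧
        cs.IsPrefix (w₁ * cs.join (cs.compl w₁ a) w₂) d := by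
    intro d had hwd
    have hd := h.trans hwd
    have hj := hle d hd had
    rw [← mul_compl] at hj
    exact hd.mul (h₃ _ (hw.of_mul hj) (h.of_mul hwd))
  have hk := (key w₀ (hw₀ _) (hw₀ _)).1
  have hj := (hk.mul (b := cs.compl w₁ a) (by simpa using h₁)).2
  refine ⟨(cs.isJoin_join a (w₁ * w₂)).eq
    ⟨ha.trans hj, (hk.mul (b := w₂) (by simpa using h₂)).2, fun d h h' => (key d h h').2⟩, ?_⟩
  rwa [join_comm, ← mul_compl]

theorem compl_mul_left [Finite W] {w₁ w₂ : W}
    (h : cs.length (w₁ * w₂) = cs.length w₁ + cs.length w₂) (a : W) :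
    cs.compl (w₁ * w₂) a = cs.compl w₂ (cs.compl w₁ a) := by
  rw [compl, join_comm, (cs.join_mul (cs.isPrefix_mul_iff.2 h) a).1,
    compl.eq_1 cs w₂, join_comm cs w₂]
  group

theorem compl_mul_right [Finite W] {w₁ w₂ : W}
    (h : cs.length (w₁ * w₂) = cs.length w₁ + cs.length w₂) (a : W) :
    cs.compl a (w₁ * w₂) = cs.compl a w₁ * cs.compl (cs.compl w₁ a) w₂ ∧
      cs.length (cs.compl a w₁ * cs.compl (cs.compl w₁ a) w₂) =
        cs.length (cs.compl a w₁) + cs.length (cs.compl (cs.compl w₁ a) w₂) := by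
  obtain ⟨h₁, h₂⟩ := cs.join_mul (cs.isPrefix_mul_iff.2 h) a
  have h₃ : (cs.join a w₁)⁻¹ * (w₁ * cs.join (cs.compl w₁ a) w₂) =
      cs.compl (cs.compl w₁ a) w₂ := by
    rw [join_comm, ← mul_compl, compl.eq_1 cs (cs.compl w₁ a)]
    group
  have h₄ := (cs.isJoin_join a w₁).1.length_inv_mul h₂
  have h₅ : cs.compl a (w₁ * w₂) = cs.compl a w₁ * cs.compl (cs.compl w₁ a) w₂ := by
    rw [← h₃, compl, compl, h₁]
    group
  refine ⟨h₅, ?_⟩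
  rw [← h₅, ← h₃, compl.eq_1 cs a, h₁, h₄, ← compl.eq_1 cs a]

@[simp] theorem one_compl [Finite W] (a : W) : cs.compl 1 a = a := by
  rw [compl, inv_one, one_mul]
  exact (cs.isJoin_join 1 a).eq ⟨cs.one_isPrefix a, cs.isPrefix_refl a, fun _ _ h => h⟩

@[simp] theorem compl_one [Finite W] (a : W) : cs.compl a 1 = 1 := by
  rw [compl, inv_mul_eq_one]
  exact IsJoin.eq ⟨cs.isPrefix_refl a, cs.one_isPrefix a, fun _ h _ => h⟩ (cs.isJoin_join a 1)

@[simp] theorem compl_self [Finite W] (a : W) : cs.compl a a = 1 := by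
  rw [compl, inv_mul_eq_one]
  exact IsJoin.eq ⟨cs.isPrefix_refl a, cs.isPrefix_refl a, fun _ h _ => h⟩ (cs.isJoin_join a a)

end CoxeterSystem

/-! ### Cancellation in the braid monoid -/

section BraidMonoid

variable (cs : CoxeterSystem M W)

theorem bOf_mul_bOf {w₁ w₂ : W} (h : cs.length (w₁ * w₂) = cs.length w₁ + cs.length w₂) :
    bOf cs w₁ * bOf cs w₂ = bOf cs (w₁ * w₂) :=
  PresentedMonoid.mk_eq_mk_of_rel ⟨w₁, w₂, h, rfl, rfl⟩

theorem BraidMonoid.bOf_induction {p : BraidMonoid cs → Prop} (one : p 1)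
    (mul : ∀ a b, p b → p (bOf cs a * b)) (b : BraidMonoid cs) : p b := by
  obtain ⟨b, rfl⟩ := PresentedMonoid.surjective_mk b
  induction b using FreeMonoid.inductionOn' with
  | one => exact one
  | of_mul a b ih => rw [map_mul]; exact mul a _ ih

/-- `𝐰` transforms `(b, a)` into `(b · (a \ w), w \ a)`. -/
noncomputable def bResidue [Finite W] : BraidMonoid cs →* (Function.End (BraidMonoid cs × W))ᵐᵒᵖ :=
  PresentedMonoid.lift (rels := braidRel cs) (M := (Function.End (BraidMonoid cs × W))ᵐᵒᵖ)
    (fun w => MulOpposite.op fun p => (p.1 * bOf cs (cs.compl p.2 w), cs.compl w p.2)) (by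
    intro x y hxy
    obtain ⟨w₁, w₂, h, rfl, rfl⟩ := hxy
    simp only [map_mul, FreeMonoid.lift_eval_of]
    apply MulOpposite.unop_injective
    funext ⟨b, a⟩
    change (b * bOf cs (cs.compl a w₁) * bOf cs (cs.compl (cs.compl w₁ a) w₂),
        cs.compl w₂ (cs.compl w₁ a)) =
      (b * bOf cs (cs.compl a (w₁ * w₂)), cs.compl (w₁ * w₂) a)
    rw [cs.compl_mul_left h, (cs.compl_mul_right h a).1, mul_assoc,
      bOf_mul_bOf cs (cs.compl_mul_right h a).2])

theorem bResidue_bOf_mul [Finite W] (w : W) (b : BraidMonoid cs) (p : BraidMonoid cs × W) :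
    (bResidue cs (bOf cs w * b)).unop p =
      (bResidue cs b).unop (p.1 * bOf cs (cs.compl p.2 w), cs.compl w p.2) := by
  rw [map_mul]; rfl

theorem bResidue_apply_one [Finite W] (b c : BraidMonoid cs) :
    (bResidue cs b).unop (c, 1) = (c * b, 1) := by
  induction b using BraidMonoid.bOf_induction generalizing c with
  | one => rw [map_one, mul_one]; rfl
  | mul a b ih => rw [bResidue_bOf_mul, cs.compl_one, cs.one_compl, ih, mul_assoc]

theorem bOf_one_mul {b : BraidMonoid cs} (hb : b ≠ 1) : bOf cs 1 * b = b := by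
  induction b using BraidMonoid.bOf_induction with
  | one => exact absurd rfl hb
  | mul a b => rw [← mul_assoc, bOf_mul_bOf cs (by simp), one_mul]

/-- Left cancellation; `bOf cs 1` appears because it differs from `1`. -/
theorem bOf_one_mul_eq_of_mul_eq_mul [Finite W] {y a b : BraidMonoid cs} (h : y * a = y * b) :
    bOf cs 1 * a = bOf cs 1 * b := by
  induction y using BraidMonoid.bOf_induction with
  | one => rw [one_mul, one_mul] at h; rw [h]
  | mul w y ih =>
    rw [mul_assoc, mul_assoc] at h
    have h' := congrArg (fun c => (bResidue cs c).unop (1, w)) h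
    simp only [bResidue_bOf_mul, cs.compl_self, bResidue_apply_one, one_mul,
      Prod.mk.injEq, and_true] at h'
    by_cases hy : y = 1
    · simpa [hy] using h'
    · rw [← mul_assoc, ← mul_assoc, bOf_one_mul cs hy] at h'
      exact ih h'

@[simp] theorem bLen_bOf (w : W) : bLen cs (bOf cs w) = Multiplicative.ofAdd (cs.length w) := rfl

/-- `b` has length zero. -/
theorem bLen_eq_one_iff {b : BraidMonoid cs} : bLen cs b = 1 ↔ b = 1 ∨ b = bOf cs 1 := by
  refine ⟨fun h => ?_, ?_⟩
  · induction b using BraidMonoid.bOf_induction with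
    | one => exact .inl rfl
    | mul a b ih =>
      rw [map_mul, mul_eq_one, bLen_bOf, ofAdd_eq_one, cs.length_eq_zero_iff] at h
      obtain ⟨rfl, hb⟩ := h
      rcases ih hb with rfl | rfl
      · exact .inr (mul_one _)
      · exact .inr (by rw [bOf_mul_bOf cs (by simp), one_mul])
  · rintro (rfl | rfl) <;> simp

theorem eq_of_mul_eq_mul_of_bLen_ne_one [Finite W] {y a b : BraidMonoid cs} (h : y * a = y * b)
    (hb : bLen cs b ≠ 1) : a = b := by
  have h₁ := bOf_one_mul_eq_of_mul_eq_mul cs h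
  have h₂ : bLen cs a = bLen cs b := by simpa using congrArg (bLen cs) h₁
  have ha : a ≠ 1 := by
    rintro rfl
    exact hb (by simpa using h₂.symm)
  rwa [bOf_one_mul cs ha, bOf_one_mul cs (by rintro rfl; simp at hb)] at h₁

end BraidMonoid

/-! ### Completing squares -/

section EChain

variable {cs : CoxeterSystem M W} {F : BraidMonoid cs ≃* BraidMonoid cs}

theorem bLen_eq_one_of_map (hF : F (bOf cs 1) = bOf cs 1) {b : BraidMonoid cs}
    (h : bLen cs (F b) = 1) : bLen cs b = 1 := by
  rw [bLen_eq_one_iff] at h ⊢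
  exact h.imp (fun h => (map_eq_one_iff F F.injective).1 h) fun h => F.injective (h.trans hF.symm)

theorem bLen_mul_map_ne_one (hF : F (bOf cs 1) = bOf cs 1) {y z : BraidMonoid cs}
    (h : bLen cs (y * z) ≠ 1) : bLen cs (z * F y) ≠ 1 := by
  contrapose! h
  rw [map_mul, mul_eq_one] at h ⊢
  exact ⟨bLen_eq_one_of_map hF h.2, h.1⟩

theorem eq_mul_map_of_mul_eq [Finite W] (hF : F (bOf cs 1) = bOf cs 1) {y z w₁ : BraidMonoid cs}
    (h : bLen cs (y * z) ≠ 1) (h₁ : y * w₁ = y * z * F.toMonoidHom y) : w₁ = z * F y := by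
  rw [mul_assoc] at h₁
  exact eq_of_mul_eq_mul_of_bLen_ne_one cs h₁ (bLen_mul_map_ne_one hF h)

theorem EChain.exists_strip [Finite W] (hF : F (bOf cs 1) = bOf cs 1) {w w₁ : BraidMonoid cs}
    {L : List (BraidMonoid cs)} (hL : EChain cs F.toMonoidHom w w₁ L) {y z : BraidMonoid cs}
    (hyz : y * z = w) (hw : bLen cs w ≠ 1) :
    ∃ (L' : List (BraidMonoid cs)) (y' z' : BraidMonoid cs), y' * z' = w₁ ∧ bLen cs w₁ ≠ 1 ∧
      EChain cs F.toMonoidHom (z * F y) (z' * F y') L' ∧ L.prod * y' = y * L'.prod := by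
  induction hL generalizing y z with
  | nil w => exact ⟨[], y, z, hyz, hw, .nil _, by simp⟩
  | @cons w v w₁ x L hx hv _ ih =>
    obtain ⟨x', rfl⟩ := hx
    obtain rfl := eq_mul_map_of_mul_eq hF hw hv
    obtain ⟨L', y', z', h₁, h₂, h₃, h₄⟩ := ih rfl (bLen_mul_map_ne_one hF hw)
    refine ⟨z :: L', y', z', h₁, h₂, .cons ⟨_, rfl⟩ ?_ h₃, ?_⟩
    · change z * (F x * F x') = z * F y * F z
      rw [← map_mul, ← hyz, map_mul, mul_assoc]
    · rw [List.prod_cons, List.prod_cons, mul_assoc, h₄, ← mul_assoc, ← mul_assoc, hyz]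

theorem EChain.exists_square [Finite W] (hF : F (bOf cs 1) = bOf cs 1)
    {w w₁ w₂ : BraidMonoid cs} {K L : List (BraidMonoid cs)}
    (hK : EChain cs F.toMonoidHom w w₂ K) (hL : EChain cs F.toMonoidHom w w₁ L)
    (hw : bLen cs w ≠ 1) :
    ∃ (u : BraidMonoid cs) (K' L' : List (BraidMonoid cs)), EChain cs F.toMonoidHom w₁ u K' ∧
      EChain cs F.toMonoidHom w₂ u L' ∧ L.prod * K'.prod = K.prod * L'.prod := by
  induction hK generalizing w₁ L with
  | nil w => exact ⟨w₁, [], L, .nil _, hL, by simp⟩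
  | @cons w v w₂ y K hy hv _ ih =>
    obtain ⟨z, rfl⟩ := hy
    obtain rfl := eq_mul_map_of_mul_eq hF hw hv
    obtain ⟨L', y', z', rfl, h₂, h₃, h₄⟩ := hL.exists_strip hF rfl hw
    obtain ⟨u, K'', L'', h₅, h₆, h₇⟩ := ih h₃ (bLen_mul_map_ne_one hF hw)
    refine ⟨u, y' :: K'', L'', .cons ⟨z', rfl⟩ ?_ h₅, h₆, ?_⟩
    · exact (mul_assoc _ _ _).symm
    · rw [List.prod_cons, List.prod_cons, ← mul_assoc, h₄, mul_assoc, h₇, mul_assoc]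

/-- A chain starting at an element of length zero ends at one and has a product of length zero;
it starts at `1` only if it is constant. -/
theorem EChain.of_bLen_eq_one (hF : F (bOf cs 1) = bOf cs 1) {w w₁ : BraidMonoid cs}
    {L : List (BraidMonoid cs)} (hL : EChain cs F.toMonoidHom w w₁ L) (hw : bLen cs w = 1) :
    (L.prod = 1 ∧ w₁ = w) ∨ (w = bOf cs 1 ∧ L.prod = bOf cs 1 ∧ (w₁ = bOf cs 1 ∨ w₁ = 1)) := by
  have he : bOf cs 1 * bOf cs 1 = bOf cs 1 := by rw [bOf_mul_bOf cs (by simp), one_mul]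
  induction hL with
  | nil w => exact .inl ⟨rfl, rfl⟩
  | @cons w v w₁ y L hy hv _ ih =>
    obtain ⟨z, rfl⟩ := hy
    have hyz := hw
    rw [map_mul, mul_eq_one] at hyz
    rw [List.prod_cons]
    change y * v = y * z * F y at hv
    rcases (bLen_eq_one_iff cs).1 hyz.1 with rfl | rfl
    · rw [map_one, mul_one, one_mul] at hv
      subst hv
      simpa using ih (by simpa using hw)
    · have hz : bOf cs 1 * z = bOf cs 1 := by
        rcases (bLen_eq_one_iff cs).1 hyz.2 with rfl | rfl
        · exact mul_one _
        · exact he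
      rw [hz, hF, he] at hv
      have hv' : bLen cs v = 1 := by simpa using congrArg (bLen cs) hv
      refine .inr ⟨hz, ?_⟩
      rcases ih hv' with ⟨hL, rfl⟩ | ⟨-, hL, h₁⟩
      · exact ⟨by rw [hL, mul_one], ((bLen_eq_one_iff cs).1 hv').symm⟩
      · exact ⟨by rw [hL, he], h₁⟩

/-- Chains starting at `bOf cs 1` extend to chains ending at `1` with product `bOf cs 1`. -/
theorem EChain.exists_extend_to_one (hF : F (bOf cs 1) = bOf cs 1) {w₁ : BraidMonoid cs}
    {L : List (BraidMonoid cs)} (hL : EChain cs F.toMonoidHom (bOf cs 1) w₁ L) :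
    ∃ L' : List (BraidMonoid cs), EChain cs F.toMonoidHom w₁ 1 L' ∧
      L.prod * L'.prod = bOf cs 1 := by
  have he : bOf cs 1 * bOf cs 1 = bOf cs 1 := by rw [bOf_mul_bOf cs (by simp), one_mul]
  have hstep : EChain cs F.toMonoidHom (bOf cs 1) 1 [bOf cs 1] := by
    refine .cons ⟨1, mul_one _⟩ ?_ (.nil _)
    change bOf cs 1 * 1 = bOf cs 1 * F (bOf cs 1)
    rw [hF, he, mul_one]
  rcases hL.of_bLen_eq_one hF (by simp) with ⟨h, rfl⟩ | ⟨-, h, rfl | rfl⟩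
  · exact ⟨_, hstep, by simp [h]⟩
  · exact ⟨_, hstep, by simp [h, he]⟩
  · exact ⟨_, .nil _, by simp [h]⟩

end EChain

/-- Morphisms of `D⁺` with the same source can be completed to a
commutative square: if `x ∈ Hom_{D⁺}(w, w₁)` and `y ∈ Hom_{D⁺}(w, w₂)`, then there are
`u ∈ B⁺`, `x' ∈ Hom_{D⁺}(w₁, u)` and `y' ∈ Hom_{D⁺}(w₂, u)` with `x·x' = y·y'`.
Here `F` is the automorphism of `B⁺` induced by an automorphism `σ` of the Coxeter
system `(W, S)`. -/
theorem stmt5 [Finite W] (cs : CoxeterSystem M W)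
    (σ : MulAut W) (hσ : σ '' Set.range cs.simple = Set.range cs.simple)
    (F : BraidMonoid cs ≃* BraidMonoid cs)
    (hF : ∀ v : W, F (bOf cs v) = bOf cs (σ v))
    (w w₁ w₂ x y : BraidMonoid cs)
    (hx : ∃ L : List (BraidMonoid cs), L.prod = x ∧ EChain cs F.toMonoidHom w w₁ L)
    (hy : ∃ L : List (BraidMonoid cs), L.prod = y ∧ EChain cs F.toMonoidHom w w₂ L) :
    ∃ u x' y' : BraidMonoid cs,
      (∃ L : List (BraidMonoid cs), L.prod = x' ∧ EChain cs F.toMonoidHom w₁ u L) ∧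
      (∃ L : List (BraidMonoid cs), L.prod = y' ∧ EChain cs F.toMonoidHom w₂ u L) ∧
      x * x' = y * y' := by
  have hF1 : F (bOf cs 1) = bOf cs 1 := by rw [hF, map_one]
  obtain ⟨L, rfl, hL⟩ := hx
  obtain ⟨K, rfl, hK⟩ := hy
  suffices h : ∃ (u : BraidMonoid cs) (K' L' : List (BraidMonoid cs)),
      EChain cs F.toMonoidHom w₁ u K' ∧ EChain cs F.toMonoidHom w₂ u L' ∧
      L.prod * K'.prod = K.prod * L'.prod by
    obtain ⟨u, K', L', hK', hL', h⟩ := h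
    exact ⟨u, _, _, ⟨K', rfl, hK'⟩, ⟨L', rfl, hL'⟩, h⟩
  by_cases hw : bLen cs w = 1
  · by_cases hw' : w = bOf cs 1
    · subst hw'
      obtain ⟨K', hK', hLK'⟩ := hL.exists_extend_to_one hF1
      obtain ⟨L', hL', hKL'⟩ := hK.exists_extend_to_one hF1
      exact ⟨1, K', L', hK', hL', hLK'.trans hKL'.symm⟩
    · obtain ⟨hL₁, rfl⟩ := (hL.of_bLen_eq_one hF1 hw).resolve_right fun h => hw' h.1
      obtain ⟨hK₁, rfl⟩ := (hK.of_bLen_eq_one hF1 hw).resolve_right fun h => hw' h.1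
      exact ⟨_, [], [], .nil _, .nil _, by rw [hL₁, hK₁]⟩
  · exact hK.exists_square hF1 hL hw
end
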